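/- arXiv:1301.7349 — 2 statements merged into one kernel-verified Lean document; each statement's English description precedes it below -/
import Mathlib

section
/- Let f : [0,∞) → ℝ be operator convex, let L_1,…,L_n be positive operators on H and R_1,…,R_n strictly positive operators on H, and set L = ∑_{i=1}^n L_i, R = ∑_{i=1}^n R_i. Then the perspective of the sums is dominated by the non-commutative f-divergence functional: g(L,R) = R^{1/2} f(R^{−1/2} L R^{−1/2}) R^{1/2} ≤ ∑_{i=1}^n R_i^{1/2} f(R_i^{−1/2} L_i R_i^{−1/2}) R_i^{1/2} in the Loewner order. In particular, the perspective g is sub-additive. -/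
open scoped InnerProductSpace

noncomputable section

/-- A continuous function `f : [0, ∞) → ℝ` is *operator convex* if for every complex Hilbert
space `K`, all selfadjoint operators `A, B` on `K` with spectra in `[0, ∞)` and every
`λ ∈ [0, 1]` one has `f(λA + (1-λ)B) ≤ λ f(A) + (1-λ) f(B)` in the Loewner order, where
`f(A)` is given by the continuous functional calculus. -/
def OperatorConvexOn (f : ℝ → ℝ) : Prop :=
  ∀ (K : Type) [NormedAddCommGroup K] [InnerProductSpace ℂ K] [CompleteSpace K],
    ∀ A B : K →L[ℂ] K, IsSelfAdjoint A → IsSelfAdjoint B →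
      spectrum ℝ A ⊆ Set.Ici (0 : ℝ) → spectrum ℝ B ⊆ Set.Ici (0 : ℝ) →
      ∀ lam : ℝ, lam ∈ Set.Icc (0 : ℝ) 1 →
        cfc f (lam • A + (1 - lam) • B) ≤ lam • cfc f A + (1 - lam) • cfc f B

variable {H : Type} [NormedAddCommGroup H] [InnerProductSpace ℂ H] [CompleteSpace H]

/-- `R^{1/2}` via the continuous functional calculus. -/
def opSqrt (R : H →L[ℂ] H) : H →L[ℂ] H := cfc Real.sqrt R

/-- `R^{-1/2}` via the continuous functional calculus. -/
def opInvSqrt (R : H →L[ℂ] H) : H →L[ℂ] H := cfc (fun t : ℝ => (Real.sqrt t)⁻¹) R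

/-- The non-commutative perspective `g(L, R) = R^{1/2} f(R^{-1/2} L R^{-1/2}) R^{1/2}`. -/
def persp (f : ℝ → ℝ) (L R : H →L[ℂ] H) : H →L[ℂ] H :=
  opSqrt R * cfc f (opInvSqrt R * L * opInvSqrt R) * opSqrt R

open ContinuousLinearMap in
/-- The continuous functional calculus respects intertwining relations `B V = V A`. -/
theorem cfc_intertwine {E F : Type*} [NormedAddCommGroup E] [InnerProductSpace ℂ E]
    [CompleteSpace E] [NormedAddCommGroup F] [InnerProductSpace ℂ F] [CompleteSpace F]
    {f : ℝ → ℝ} (hf : ContinuousOn f (Set.Ici (0 : ℝ))) {A : E →L[ℂ] E} {B : F →L[ℂ] F}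
    (hA : 0 ≤ A) (hB : 0 ≤ B) {V : E →L[ℂ] F} (h : B ∘L V = V ∘L A) :
    cfc f B ∘L V = V ∘L cfc f A := by
  have hsA : IsSelfAdjoint A := .of_nonneg hA
  have hsB : IsSelfAdjoint B := .of_nonneg hB
  have hpoly (p : Polynomial ℝ) : Polynomial.aeval B p ∘L V = V ∘L Polynomial.aeval A p := by
    induction p using Polynomial.induction_on' with
    | add p q hp hq => rw [map_add, map_add, add_comp, comp_add, hp, hq]
    | monomial n a =>
      have hpow : (B ^ n) ∘L V = V ∘L (A ^ n) := by
        induction n with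
        | zero => rfl
        | succ n ih =>
          rw [pow_succ, pow_succ', mul_def, mul_def, comp_assoc, h, ← comp_assoc, ih, comp_assoc,
            ← mul_def, ← mul_def, ← pow_succ, ← pow_succ']
      simp only [Polynomial.aeval_monomial, ← Algebra.smul_def, smul_comp, comp_smul, hpow]
  obtain ⟨M, hM⟩ := ((ContinuousFunctionalCalculus.isCompact_spectrum (R := ℝ) A).union
    (ContinuousFunctionalCalculus.isCompact_spectrum (R := ℝ) B)).bddAbove
  have hmemA : spectrum ℝ A ⊆ Set.Icc 0 M := fun x hx =>
    ⟨spectrum_nonneg_of_nonneg hA hx, hM (.inl hx)⟩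
  have hmemB : spectrum ℝ B ⊆ Set.Icc 0 M := fun x hx =>
    ⟨spectrum_nonneg_of_nonneg hB hx, hM (.inr hx)⟩
  have hfM : ContinuousOn f (Set.Icc 0 M) := hf.mono fun x hx => hx.1
  have hbound : ∀ ε > 0, ‖cfc f B ∘L V - V ∘L cfc f A‖ ≤ ε * (2 * ‖V‖) := by
    intro ε hε
    obtain ⟨p, hp⟩ := exists_polynomial_near_of_continuousOn 0 M f hfM ε hε
    have hdecomp : cfc f B ∘L V - V ∘L cfc f A = V ∘L (Polynomial.aeval A p - cfc f A)
        - (Polynomial.aeval B p - cfc f B) ∘L V := by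
      rw [comp_sub, sub_comp, hpoly]; abel
    rw [hdecomp]
    have hkA : ‖Polynomial.aeval A p - cfc f A‖ ≤ ε := by
      rw [← cfc_polynomial p A, ← cfc_sub _ _ A (by fun_prop) (hfM.mono hmemA)]
      exact norm_cfc_le hε.le fun x hx => (hp x (hmemA hx)).le
    have hkB : ‖Polynomial.aeval B p - cfc f B‖ ≤ ε := by
      rw [← cfc_polynomial p B, ← cfc_sub _ _ B (by fun_prop) (hfM.mono hmemB)]
      exact norm_cfc_le hε.le fun x hx => (hp x (hmemB hx)).le
    calc _ ≤ ‖V‖ * ‖Polynomial.aeval A p - cfc f A‖ + ‖Polynomial.aeval B p - cfc f B‖ * ‖V‖ :=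
          (norm_sub_le _ _).trans (add_le_add (opNorm_comp_le _ _) (opNorm_comp_le _ _))
      _ ≤ ‖V‖ * ε + ε * ‖V‖ := by gcongr
      _ = _ := by ring
  have hlim : Filter.Tendsto (fun ε : ℝ => ε * (2 * ‖V‖)) (nhdsWithin 0 (Set.Ioi 0)) (nhds 0) := by
    have : Filter.Tendsto (fun ε : ℝ => ε * (2 * ‖V‖)) (nhds 0) (nhds (0 * (2 * ‖V‖))) :=
      (continuous_id.mul continuous_const).tendsto 0
    rw [zero_mul] at this
    exact this.mono_left nhdsWithin_le_nhds
  rw [← sub_eq_zero, ← norm_le_zero_iff]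
  exact ge_of_tendsto hlim (by filter_upwards [self_mem_nhdsWithin] with ε hε using hbound ε hε)

open ContinuousLinearMap in
/-- Jensen's operator inequality for compression by an isometry. -/
theorem OperatorConvexOn.jensen_isometry {f : ℝ → ℝ} (hf : OperatorConvexOn f)
    (hc : ContinuousOn f (Set.Ici (0 : ℝ)))
    {E K : Type} [NormedAddCommGroup E] [InnerProductSpace ℂ E] [CompleteSpace E]
    [NormedAddCommGroup K] [InnerProductSpace ℂ K] [CompleteSpace K]
    {X : K →L[ℂ] K} (hX : 0 ≤ X) {V : E →L[ℂ] K} (hV : adjoint V ∘L V = 1) :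
    cfc f (adjoint V ∘L X ∘L V) ≤ adjoint V ∘L cfc f X ∘L V := by
  have hVV (x : E) : adjoint V (V x) = x := congr($hV x)
  set W : K →L[ℂ] K := (2 : ℝ) • (V ∘L adjoint V) - 1 with hW
  have hWx (y : K) : W y = (2 : ℝ) • V (adjoint V y) - y := rfl
  have hWV (x : E) : W (V x) = V x := by
    rw [hWx, hVV, two_smul, add_sub_cancel_right]
  have hVW (y : K) : adjoint V (W y) = adjoint V y := by
    rw [hWx, map_sub, two_smul, map_add, hVV, add_sub_cancel_right]
  have hWW (y : K) : W (W y) = y := by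
    rw [hWx (W y), hVW, hWx]; abel
  have hWsa : adjoint W = W := by
    refine ((eq_adjoint_iff W W).2 fun x y => ?_).symm
    simp only [hWx, two_smul, inner_sub_left, inner_sub_right, inner_add_left, inner_add_right,
      ← adjoint_inner_right V, ← adjoint_inner_left V]
  have hWXW : 0 ≤ W ∘L X ∘L W := by
    have := ((nonneg_iff_isPositive X).1 hX).adjoint_conj W
    rw [hWsa] at this
    exact (nonneg_iff_isPositive _).2 this
  have hcomp : 0 ≤ adjoint V ∘L X ∘L V :=
    (nonneg_iff_isPositive _).2 (((nonneg_iff_isPositive X).1 hX).adjoint_conj V)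
  have hfW (y : K) : cfc f (W ∘L X ∘L W) y = W (cfc f X (W y)) := by
    have h := cfc_intertwine hc hX hWXW (V := W) (by ext y; simp [hWW])
    have := congr($h (W y))
    simpa [hWW] using this
  set Y : K →L[ℂ] K := (1 / 2 : ℝ) • X + (1 - 1 / 2 : ℝ) • (W ∘L X ∘L W) with hY
  have hY0 : 0 ≤ Y := add_nonneg (smul_nonneg (by norm_num) hX) (smul_nonneg (by norm_num) hWXW)
  have hYV : Y ∘L V = V ∘L (adjoint V ∘L X ∘L V) := by
    ext x
    have : Y (V x) = (1 / 2 : ℝ) • X (V x) + (1 - 1 / 2 : ℝ) • W (X (W (V x))) := rfl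
    simp only [comp_apply]
    rw [this, hWV, hWx]
    module
  have hfY := cfc_intertwine hc hcomp hY0 hYV
  have hconv := hf K X (W ∘L X ∘L W) (.of_nonneg hX) (.of_nonneg hWXW)
    (fun x hx => spectrum_nonneg_of_nonneg hX hx) (fun x hx => spectrum_nonneg_of_nonneg hWXW hx)
    (1 / 2) (by norm_num)
  rw [← hY, le_def] at hconv
  rw [le_def]
  convert hconv.adjoint_conj V using 1
  ext x
  have hx : cfc f Y (V x) = V (cfc f (adjoint V ∘L X ∘L V) x) := congr($hfY x)
  simp only [comp_apply, sub_apply, add_apply, smul_apply, map_sub, map_add, hfW, hWV, hx, hVV]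
  rw [map_smul_of_tower, map_smul_of_tower, hVW]
  module

open ContinuousLinearMap in
/-- Jensen's operator inequality for operator convex combinations. -/
theorem OperatorConvexOn.jensen_sum {f : ℝ → ℝ} (hf : OperatorConvexOn f)
    (hc : ContinuousOn f (Set.Ici (0 : ℝ)))
    {E ι : Type} [NormedAddCommGroup E] [InnerProductSpace ℂ E] [CompleteSpace E] [Fintype ι]
    {A T : ι → E →L[ℂ] E} (hA : ∀ i, 0 ≤ A i) (hT : ∑ i, star (T i) * T i = 1) :
    cfc f (∑ i, star (T i) * A i * T i) ≤ ∑ i, star (T i) * cfc f (A i) * T i := by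
  classical
  let p (i : ι) : PiLp 2 (fun _ : ι => E) →L[ℂ] E := PiLp.proj 2 (fun _ : ι => E) i
  have hp (i j : ι) (x : E) : p i (adjoint (p j) x) = if i = j then x else 0 := by
    have hsingle : adjoint (p j) x = PiLp.single 2 j x := by
      refine ext_inner_left ℂ fun y => ?_
      rw [adjoint_inner_right, PiLp.inner_apply, Finset.sum_eq_single j]
      · simp [p]
      · intro k _ hk
        simp [hk]
      · simp
    rw [hsingle]
    rcases eq_or_ne i j with rfl | h
    · simp [p]
    · simp [p, h]
  let V : E →L[ℂ] PiLp 2 (fun _ : ι => E) := ∑ i, adjoint (p i) ∘L T i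
  let X : PiLp 2 (fun _ : ι => E) →L[ℂ] PiLp 2 (fun _ : ι => E) :=
    ∑ i, adjoint (p i) ∘L A i ∘L p i
  have hpV (i : ι) (x : E) : p i (V x) = T i x := by
    simp [V, sum_apply, hp]
  have hpX (i : ι) : p i ∘L X = A i ∘L p i := by
    ext y
    simp [X, sum_apply, hp]
  have hX : 0 ≤ X := Finset.sum_nonneg fun i _ =>
    (nonneg_iff_isPositive _).2 (((nonneg_iff_isPositive _).1 (hA i)).adjoint_conj (p i))
  have hVadj (y : PiLp 2 (fun _ : ι => E)) : adjoint V y = ∑ i, star (T i) (p i y) := by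
    simp [V, map_sum, adjoint_comp, sum_apply, star_eq_adjoint]
  have hVV : adjoint V ∘L V = 1 := by
    rw [← hT]
    ext x
    simp [hVadj, hpV, sum_apply]
  have hVXV : adjoint V ∘L X ∘L V = ∑ i, star (T i) * A i * T i := by
    ext x
    have (i : ι) : p i (X (V x)) = A i (T i x) := by
      rw [← hpV]; exact congr($(hpX i) (V x))
    simp [hVadj, this, sum_apply]
  have hVfV : adjoint V ∘L cfc f X ∘L V = ∑ i, star (T i) * cfc f (A i) * T i := by
    ext x
    have (i : ι) : p i (cfc f X (V x)) = cfc f (A i) (T i x) := by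
      rw [← hpV]; exact congr($(cfc_intertwine hc hX (hA i) (hpX i).symm) (V x)).symm
    simp [hVadj, this, sum_apply]
  rw [← hVXV, ← hVfV]
  exact hf.jensen_isometry hc hX hVV

theorem isSelfAdjoint_opSqrt (R : H →L[ℂ] H) : IsSelfAdjoint (opSqrt R) := cfc_predicate _ _

theorem isSelfAdjoint_opInvSqrt (R : H →L[ℂ] H) : IsSelfAdjoint (opInvSqrt R) :=
  cfc_predicate _ _

theorem opSqrt_mul_self {R : H →L[ℂ] H} (hR : 0 ≤ R) : opSqrt R * opSqrt R = R := by
  rw [opSqrt, ← cfc_mul _ _ R]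
  conv_rhs => rw [← cfc_id' ℝ R]
  exact cfc_congr fun x hx => Real.mul_self_sqrt (spectrum_nonneg_of_nonneg hR hx)

theorem opSqrt_mul_opInvSqrt {R : H →L[ℂ] H} (hR : 0 ≤ R) (hu : IsUnit R) :
    opSqrt R * opInvSqrt R = 1 := by
  have hpos (x : ℝ) (hx : x ∈ spectrum ℝ R) : Real.sqrt x ≠ 0 := by
    have h0 : x ≠ 0 := fun h => spectrum.zero_notMem ℝ hu (h ▸ hx)
    exact (Real.sqrt_pos.2 ((spectrum_nonneg_of_nonneg hR hx).lt_of_ne' h0)).ne'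
  have hcont : ContinuousOn (fun t : ℝ => (Real.sqrt t)⁻¹) (spectrum ℝ R) :=
    Real.continuous_sqrt.continuousOn.inv₀ hpos
  rw [opSqrt, opInvSqrt, ← cfc_mul _ _ R (by fun_prop) hcont, ← cfc_const_one ℝ R]
  exact cfc_congr fun x hx => mul_inv_cancel₀ (hpos x hx)

theorem opInvSqrt_mul_opSqrt {R : H →L[ℂ] H} (hR : 0 ≤ R) (hu : IsUnit R) :
    opInvSqrt R * opSqrt R = 1 := by
  simpa [(isSelfAdjoint_opSqrt R).star_eq, (isSelfAdjoint_opInvSqrt R).star_eq] using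
    congr(star $(opSqrt_mul_opInvSqrt hR hu))

/-- A nonempty sum of strictly positive operators is invertible. -/
theorem isUnit_sum_of_nonneg {ι : Type*} [Fintype ι] [Nonempty ι] {R : ι → H →L[ℂ] H}
    (hR : ∀ i, 0 ≤ R i ∧ IsUnit (R i)) : IsUnit (∑ i, R i) := by
  classical
  obtain ⟨i⟩ := ‹Nonempty ι›
  exact CStarAlgebra.isUnit_of_le (R i)
    (Finset.single_le_sum (fun j _ => (hR j).1) (Finset.mem_univ i))
    ((hR i).2.isStrictlyPositive (hR i).1)

/-- The perspective of the sums is dominated by the non-commutative `f`-divergence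
functional: `g(∑ L i, ∑ R i) ≤ ∑ i, g(L i, R i)`; in particular the perspective is
sub-additive. -/
theorem stmt_1 (f : ℝ → ℝ) (hf_cont : ContinuousOn f (Set.Ici (0 : ℝ)))
    (hf : OperatorConvexOn f) (n : ℕ)
    (L R : Fin n → H →L[ℂ] H)
    (hL : ∀ i, 0 ≤ L i) (hR : ∀ i, 0 ≤ R i ∧ IsUnit (R i)) :
    persp f (∑ i, L i) (∑ i, R i) ≤ ∑ i, persp f (L i) (R i) := by
  rcases isEmpty_or_nonempty (Fin n) with _ | _
  · simp [persp, opSqrt]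
  have hS0 : 0 ≤ ∑ i, R i := Finset.sum_nonneg fun i _ => (hR i).1
  have hSu : IsUnit (∑ i, R i) := isUnit_sum_of_nonneg hR
  set S := opSqrt (∑ i, R i) with hS
  set J := opInvSqrt (∑ i, R i) with hJ
  have hSsa : star S = S := isSelfAdjoint_opSqrt _
  have hJsa : star J = J := isSelfAdjoint_opInvSqrt _
  have hSJ : S * J = 1 := opSqrt_mul_opInvSqrt hS0 hSu
  have hJS : J * S = 1 := opInvSqrt_mul_opSqrt hS0 hSu
  have hstar (i : Fin n) : star (opSqrt (R i) * J) = J * opSqrt (R i) := by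
    rw [star_mul, hJsa, (isSelfAdjoint_opSqrt (R i)).star_eq]
  have hA (i : Fin n) : 0 ≤ opInvSqrt (R i) * L i * opInvSqrt (R i) :=
    (isSelfAdjoint_opInvSqrt (R i)).conjugate_nonneg (hL i)
  have hT : ∑ i, star (opSqrt (R i) * J) * (opSqrt (R i) * J) = 1 := by
    have (i : Fin n) : star (opSqrt (R i) * J) * (opSqrt (R i) * J) = J * R i * J := by
      rw [hstar, mul_assoc, ← mul_assoc (opSqrt (R i)), opSqrt_mul_self (hR i).1, mul_assoc]
    simp_rw [this, ← Finset.sum_mul, ← Finset.mul_sum]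
    rw [← opSqrt_mul_self hS0, ← hS, ← mul_assoc, hJS, one_mul, hSJ]
  have key := hf.jensen_sum hf_cont hA hT
  have hcomp (i : Fin n) : star (opSqrt (R i) * J) * (opInvSqrt (R i) * L i * opInvSqrt (R i)) *
      (opSqrt (R i) * J) = J * L i * J := by
    calc _ = J * (opSqrt (R i) * opInvSqrt (R i)) * L i * (opInvSqrt (R i) * opSqrt (R i)) * J := by
          rw [hstar]; simp only [mul_assoc]
      _ = _ := by
          rw [opSqrt_mul_opInvSqrt (hR i).1 (hR i).2, opInvSqrt_mul_opSqrt (hR i).1 (hR i).2,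
            mul_one, mul_one]
  simp_rw [hcomp, ← Finset.sum_mul, ← Finset.mul_sum] at key
  have := IsSelfAdjoint.conjugate_le_conjugate key hSsa
  refine this.trans_eq ?_
  rw [Finset.mul_sum, Finset.sum_mul]
  refine Finset.sum_congr rfl fun i _ => ?_
  calc _ = (S * J) * opSqrt (R i) * cfc f (opInvSqrt (R i) * L i * opInvSqrt (R i)) *
        opSqrt (R i) * (J * S) := by rw [hstar]; simp only [mul_assoc]
    _ = _ := by rw [hSJ, hJS, one_mul, mul_one]; rfl
end
end

section
/- Let f : [0,∞) → ℝ be operator convex with f(0) ≤ 0, let h : [0,∞) → ℝ be operator concave with h(t) > 0 for all t ≥ 0, and let Φ be a positive linear map from bounded operators on H to bounded operators on K with Φ(I) ≤ I. Then for all positive operators A, B on H, (fΔh)(Φ(A),Φ(B)) ≤ Φ((fΔh)(A,B)) in the Loewner order. -/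
open scoped InnerProductSpace

noncomputable section

variable {H : Type} [NormedAddCommGroup H] [InnerProductSpace ℂ H] [CompleteSpace H]

/-- A continuous function `h : [0, ∞) → ℝ` is *operator concave* if `-h` is operator convex. -/
def OperatorConcaveOn (h : ℝ → ℝ) : Prop :=
  ∀ (K : Type) [NormedAddCommGroup K] [InnerProductSpace ℂ K] [CompleteSpace K],
    ∀ A B : K →L[ℂ] K, IsSelfAdjoint A → IsSelfAdjoint B →
      spectrum ℝ A ⊆ Set.Ici (0 : ℝ) → spectrum ℝ B ⊆ Set.Ici (0 : ℝ) →
      ∀ lam : ℝ, lam ∈ Set.Icc (0 : ℝ) 1 →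
        lam • cfc h A + (1 - lam) • cfc h B ≤ cfc h (lam • A + (1 - lam) • B)


/-- `(fΔh)(A, B) = h(B)^{1/2} f(h(B)^{-1/2} A h(B)^{-1/2}) h(B)^{1/2}`. -/
def fDelta (f h : ℝ → ℝ) {H : Type} [NormedAddCommGroup H] [InnerProductSpace ℂ H]
    [CompleteSpace H] (A B : H →L[ℂ] H) : H →L[ℂ] H :=
  opSqrt (cfc h B) * cfc f (opInvSqrt (cfc h B) * A * opInvSqrt (cfc h B)) * opSqrt (cfc h B)

section OperatorJensen

variable {E F : Type} [NormedAddCommGroup E] [InnerProductSpace ℂ E]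
  [NormedAddCommGroup F] [InnerProductSpace ℂ F]

theorem aeval_comp_eq_comp_aeval {S : F →L[ℂ] F} {R : E →L[ℂ] E} {V : E →L[ℂ] F}
    (h : S ∘L V = V ∘L R) (p : Polynomial ℝ) :
    Polynomial.aeval S p ∘L V = V ∘L Polynomial.aeval R p := by
  induction p using Polynomial.induction_on' with
  | add p q hp hq => simp [ContinuousLinearMap.add_comp, ContinuousLinearMap.comp_add, hp, hq]
  | monomial n a =>
    have hpow : ∀ n : ℕ, (S ^ n) ∘L V = V ∘L (R ^ n) := by
      intro n
      induction n with
      | zero => rfl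
      | succ n ih =>
        calc (S ^ (n + 1)) ∘L V = (S ^ n) ∘L (S ∘L V) := by rw [pow_succ]; rfl
          _ = ((S ^ n) ∘L V) ∘L R := by rw [h]; rfl
          _ = V ∘L (R ^ (n + 1)) := by rw [ih, pow_succ]; rfl
    ext x
    have := congr($(hpow n) x)
    simp only [ContinuousLinearMap.comp_apply] at this
    simp [Polynomial.aeval_monomial, Algebra.algebraMap_eq_smul_one, this]

/-- The column operator with the given entries. -/
def columnOp {ι : Type} [Fintype ι] (D : ι → E →L[ℂ] F) : E →L[ℂ] PiLp 2 (fun _ : ι => F) :=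
  (PiLp.continuousLinearEquiv 2 ℂ (fun _ : ι => F)).symm.toContinuousLinearMap ∘L
    ContinuousLinearMap.pi D

theorem columnOp_apply {ι : Type} [Fintype ι] (D : ι → E →L[ℂ] F) (x : E) (i : ι) :
    columnOp D x i = D i x := rfl

variable [CompleteSpace E] [CompleteSpace F]

/-- The continuous functional calculus respects intertwining operators. -/
theorem cfc_comp_eq_comp_cfc {f : ℝ → ℝ} (hf : ContinuousOn f (Set.Ici 0))
    {S : F →L[ℂ] F} {R : E →L[ℂ] E} {V : E →L[ℂ] F} (hS : 0 ≤ S) (hR : 0 ≤ R)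
    (h : S ∘L V = V ∘L R) : cfc f S ∘L V = V ∘L cfc f R := by
  have hSsa : IsSelfAdjoint S := .of_nonneg hS
  have hRsa : IsSelfAdjoint R := .of_nonneg hR
  set M := max ‖S‖ ‖R‖
  have spec : ∀ {G : Type} [NormedAddCommGroup G] [InnerProductSpace ℂ G] [CompleteSpace G]
      {T : G →L[ℂ] G}, 0 ≤ T → ‖T‖ ≤ M → spectrum ℝ T ⊆ Set.Icc 0 M := by
    intro G _ _ _ T hT hTM x hx
    refine ⟨spectrum_nonneg_of_nonneg hT hx, ?_⟩
    rcases subsingleton_or_nontrivial G with hG | hG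
    · have : Subsingleton (G →L[ℂ] G) := inferInstance
      simp [spectrum.of_subsingleton] at hx
    · exact (le_abs_self x).trans ((spectrum.norm_le_norm_of_mem hx).trans hTM)
  have approx : ∀ {G : Type} [NormedAddCommGroup G] [InnerProductSpace ℂ G] [CompleteSpace G]
      {T : G →L[ℂ] G}, 0 ≤ T → ‖T‖ ≤ M → ∀ {ε : ℝ}, 0 ≤ ε → ∀ {p : Polynomial ℝ},
      (∀ x ∈ Set.Icc 0 M, |p.eval x - f x| < ε) → ‖cfc f T - Polynomial.aeval T p‖ ≤ ε := by
    intro G _ _ _ T hT hTM ε hε p hp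
    have hTsa : IsSelfAdjoint T := .of_nonneg hT
    rw [← cfc_polynomial p T, ← cfc_sub _ _ T
      (hf.mono ((spec hT hTM).trans Set.Icc_subset_Ici_self)) p.continuous.continuousOn]
    refine norm_cfc_le hε fun x hx => ?_
    rw [Real.norm_eq_abs, abs_sub_comm]
    exact (hp x (spec hT hTM hx)).le
  rw [← sub_eq_zero, ← norm_le_zero_iff]
  refine le_of_forall_pos_le_add fun δ hδ => ?_
  have hV : 0 < 2 * (‖V‖ + 1) := by positivity
  obtain ⟨p, hp⟩ := exists_polynomial_near_of_continuousOn 0 M f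
    (hf.mono Set.Icc_subset_Ici_self) (δ / (2 * (‖V‖ + 1))) (by positivity)
  have h1 := approx hS (le_max_left _ _) (by positivity) hp
  have h2 := approx hR (le_max_right _ _) (by positivity) hp
  have key : cfc f S ∘L V - V ∘L cfc f R
      = (cfc f S - Polynomial.aeval S p) ∘L V - V ∘L (cfc f R - Polynomial.aeval R p) := by
    rw [ContinuousLinearMap.sub_comp, ContinuousLinearMap.comp_sub, aeval_comp_eq_comp_aeval h]
    abel
  rw [key, zero_add]
  refine (norm_sub_le _ _).trans ?_
  calc _ ≤ δ / (2 * (‖V‖ + 1)) * ‖V‖ + ‖V‖ * (δ / (2 * (‖V‖ + 1))) := by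
        refine add_le_add ((ContinuousLinearMap.opNorm_comp_le _ _).trans ?_)
          ((ContinuousLinearMap.opNorm_comp_le _ _).trans ?_) <;> gcongr
    _ = δ * (‖V‖ / (‖V‖ + 1)) := by field_simp; ring
    _ ≤ δ := mul_le_of_le_one_right hδ.le (div_le_one_of_le₀ (by linarith) (by positivity))

/-- The Hansen–Pedersen–Jensen inequality for isometries. -/
theorem OperatorConvexOn.cfc_isometry_conj_le {f : ℝ → ℝ} (hf : OperatorConvexOn f)
    (hfc : ContinuousOn f (Set.Ici 0)) {V : E →L[ℂ] F} (hV : V.adjoint ∘L V = 1)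
    {T : F →L[ℂ] F} (hT : 0 ≤ T) :
    cfc f (V.adjoint ∘L T ∘L V) ≤ V.adjoint ∘L cfc f T ∘L V := by
  have hVx : ∀ x, V.adjoint (V x) = x := fun x => congr($hV x)
  set U : F →L[ℂ] F := (2 : ℝ) • (V ∘L V.adjoint) - 1 with hU
  have hUsa : star U = U := by
    rw [hU, star_sub, star_smul, star_one]
    congr 2
    simp [ContinuousLinearMap.star_eq_adjoint, ContinuousLinearMap.adjoint_comp]
  have hUV : U ∘L V = V := by
    ext x
    simp [hU, hVx, two_smul]
  have hVU : V.adjoint ∘L U = V.adjoint := by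
    ext x
    simp [hU, hVx, two_smul]
  have hUU : U * U = 1 := by
    ext x
    simp [hU, hVx, two_smul]
  have hUTU : 0 ≤ U * T * U := by
    simpa [hUsa] using star_left_conjugate_nonneg hT U
  have hcU : cfc f (U * T * U) = U * cfc f T * U := by
    have h := cfc_comp_eq_comp_cfc hfc (S := U * T * U) (R := T) (V := U) hUTU hT
      (by change U * T * U * U = U * T; rw [mul_assoc, hUU, mul_one])
    change cfc f (U * T * U) * U = U * cfc f T at h
    rw [← h, mul_assoc _ U U, hUU, mul_one]
  set S : F →L[ℂ] F := (1 / 2 : ℝ) • T + (1 - 1 / 2 : ℝ) • (U * T * U) with hS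
  have hS0 : 0 ≤ S := add_nonneg (smul_nonneg (by norm_num) hT) (smul_nonneg (by norm_num) hUTU)
  have hR0 : 0 ≤ V.adjoint ∘L T ∘L V := by
    rw [ContinuousLinearMap.nonneg_iff_isPositive] at hT ⊢
    exact hT.adjoint_conj V
  have hSV : S ∘L V = V ∘L (V.adjoint ∘L T ∘L V) := by
    ext x
    have hUVx : U (V x) = V x := congr($hUV x)
    simp only [hS, ContinuousLinearMap.comp_apply, add_apply,
      smul_apply, mul_apply_eq_comp, hUVx]
    simp only [hU, ContinuousLinearMap.comp_apply, sub_apply,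
      smul_apply, one_apply_eq_self]
    module
  have hconv := hf F T (U * T * U) (.of_nonneg hT) (.of_nonneg hUTU)
    (fun x hx => spectrum_nonneg_of_nonneg hT hx)
    (fun x hx => spectrum_nonneg_of_nonneg hUTU hx) (1 / 2) (by norm_num)
  rw [hcU, ← hS, ContinuousLinearMap.le_def] at hconv
  have hpos := hconv.adjoint_conj V
  rw [ContinuousLinearMap.le_def]
  convert hpos using 1
  have hcSV := cfc_comp_eq_comp_cfc hfc hS0 hR0 hSV
  ext x
  have hUVx : U (V x) = V x := congr($hUV x)
  have hVUx : ∀ y, V.adjoint (U y) = V.adjoint y := fun y => congr($hVU y)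
  have hcSVx : cfc f S (V x) = V (cfc f (V.adjoint ∘L T ∘L V) x) := congr($hcSV x)
  simp only [ContinuousLinearMap.comp_apply, add_apply, map_sub, map_add,
      smul_apply, mul_apply_eq_comp, hUVx, hcSVx, hVx,
      sub_apply, ContinuousLinearMap.map_smul_of_tower, hVUx]
  module

/-- The operator Jensen inequality for finite positive resolutions of the identity. -/
theorem OperatorConvexOn.cfc_sum_smul_le_of_sum_eq_one {f : ℝ → ℝ} (hf : OperatorConvexOn f)
    (hfc : ContinuousOn f (Set.Ici 0)) {ι : Type} [Fintype ι] {C : ι → E →L[ℂ] E}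
    (hC : ∀ i, 0 ≤ C i) (hC1 : ∑ i, C i = 1) {t : ι → ℝ} (ht : ∀ i, 0 ≤ t i) :
    cfc f (∑ i, t i • C i) ≤ ∑ i, f (t i) • C i := by
  set V := columnOp fun i => CFC.sqrt (C i) with hVdef
  set T : PiLp 2 (fun _ : ι => E) →L[ℂ] PiLp 2 (fun _ : ι => E) :=
    columnOp fun i => t i • PiLp.proj 2 (fun _ : ι => E) i with hTdef
  have hT : 0 ≤ T := by
    rw [ContinuousLinearMap.nonneg_iff_isPositive, ContinuousLinearMap.isPositive_iff_complex]
    intro x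
    have : inner ℂ (T x) x = ((∑ i, t i * ‖x i‖ ^ 2 : ℝ) : ℂ) := by
      rw [PiLp.inner_apply]
      push_cast
      refine Finset.sum_congr rfl fun i _ => ?_
      rw [hTdef, columnOp_apply, smul_apply, inner_smul_left_eq_smul]
      rw [PiLp.proj_apply, inner_self_eq_norm_sq_to_K]
      simp
    rw [this]
    exact ⟨rfl, Finset.sum_nonneg fun i _ => mul_nonneg (ht i) (sq_nonneg _)⟩
  have hsqrt : ∀ i x y, inner ℂ (CFC.sqrt (C i) x) (CFC.sqrt (C i) y) = inner ℂ (C i x) y := by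
    intro i x y
    have hsa : IsSelfAdjoint (CFC.sqrt (C i)) := .of_nonneg (CFC.sqrt_nonneg _)
    rw [← ContinuousLinearMap.adjoint_inner_left, hsa.adjoint_eq, ← mul_apply_eq_comp,
      CFC.sqrt_mul_sqrt_self _ (hC i)]
  have compress : ∀ (c : ι → ℝ) (W : PiLp 2 (fun _ : ι => E) →L[ℂ] PiLp 2 (fun _ : ι => E)),
      (∀ x i, W x i = c i • x i) → V.adjoint ∘L W ∘L V = ∑ i, c i • C i := by
    intro c W hW
    ext x
    refine ext_inner_right ℂ fun y => ?_
    simp only [ContinuousLinearMap.comp_apply, ContinuousLinearMap.adjoint_inner_left,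
      PiLp.inner_apply, hW, hVdef, columnOp_apply, inner_smul_left_eq_smul, hsqrt]
    simp [sum_inner, inner_smul_left_eq_smul]
  have hV : V.adjoint ∘L V = 1 := by
    have := compress (fun _ => 1) (.id ℂ _) (by simp)
    simpa [hC1] using this
  have hfT : ∀ x i, cfc f T x i = f (t i) • x i := by
    intro x i
    have h := cfc_comp_eq_comp_cfc hfc (S := t i • (1 : E →L[ℂ] E)) (R := T)
      (V := PiLp.proj 2 (fun _ : ι => E) i) (smul_nonneg (ht i) zero_le_one) hT
      (by ext x; rfl)
    rw [← Algebra.algebraMap_eq_smul_one, cfc_algebraMap] at h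
    have hx := congr($h x)
    rw [Algebra.algebraMap_eq_smul_one] at hx
    exact hx.symm
  have := hf.cfc_isometry_conj_le hfc hV hT
  rwa [compress t T (fun _ _ => rfl), compress (fun i => f (t i)) _ hfT] at this

theorem OperatorConvexOn.cfc_sum_smul_le {f : ℝ → ℝ} (hf : OperatorConvexOn f)
    (hfc : ContinuousOn f (Set.Ici 0)) (hf0 : f 0 ≤ 0) {ι : Type} [Fintype ι] {C : ι → E →L[ℂ] E}
    (hC : ∀ i, 0 ≤ C i) (hC1 : ∑ i, C i ≤ 1) {t : ι → ℝ} (ht : ∀ i, 0 ≤ t i) :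
    cfc f (∑ i, t i • C i) ≤ ∑ i, f (t i) • C i := by
  have h := hf.cfc_sum_smul_le_of_sum_eq_one hfc (ι := Option ι)
    (C := fun o => o.elim (1 - ∑ i, C i) C) (t := fun o => o.elim 0 t)
    (by rintro (_ | i); exacts [sub_nonneg.2 hC1, hC i]) (by simp [Fintype.sum_option])
    (by rintro (_ | i); exacts [le_rfl, ht i])
  simp only [Fintype.sum_option, Option.elim, zero_smul, zero_add] at h
  exact h.trans (add_le_of_nonpos_left
    (smul_nonpos_of_nonpos_of_nonneg hf0 (sub_nonneg.2 hC1)))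

/-- Bernstein approximation on `[0, M]`: continuous nonnegative weights reproducing constants
and the identity, and approximating `f`. -/
theorem exists_weights_approximating {f : ℝ → ℝ} (hfc : ContinuousOn f (Set.Ici 0)) {M : ℝ}
    (hM : 0 < M) {ε : ℝ} (hε : 0 < ε) :
    ∃ (n : ℕ) (t : Fin n → ℝ) (b : Fin n → ℝ → ℝ), (∀ k, 0 ≤ t k) ∧ (∀ k, Continuous (b k)) ∧
      ∀ x ∈ Set.Icc 0 M, (∀ k, 0 ≤ b k x) ∧ ∑ k, b k x = 1 ∧ ∑ k, t k * b k x = x ∧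
        ∑ k, f (t k) * b k x ≤ f x + ε := by
  let g : C(unitInterval, ℝ) := ⟨fun y => f (M * y), hfc.comp_continuous (by fun_prop)
    fun y => mul_nonneg hM.le y.2.1⟩
  have h := (Metric.tendsto_nhds.1 (bernsteinApproximation_uniform g) ε hε).and
    (Filter.eventually_ne_atTop 0)
  obtain ⟨n, hn, hn0⟩ := h.exists
  refine ⟨n + 1, fun k => M * (k / n), fun k x => (bernsteinPolynomial ℝ n k).eval (x / M),
    fun k => by positivity, fun k => by fun_prop, fun x hx => ?_⟩
  let y : unitInterval := ⟨x / M, div_nonneg hx.1 hM.le, div_le_one_of_le₀ hx.2 hM.le⟩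
  have hb : ∀ k : Fin (n + 1), (bernsteinPolynomial ℝ n k).eval (x / M) = bernstein n k y :=
    fun k => rfl
  have hMy : M * (y : ℝ) = x := by simp only [y]; field_simp
  refine ⟨fun k => bernstein_nonneg (x := y), ?_, ?_, ?_⟩
  · simp only [hb]
    exact bernstein.probability n y
  · have := congr(Polynomial.eval (x / M) $(bernsteinPolynomial.sum_smul ℝ n))
    simp only [Polynomial.eval_finsetSum, nsmul_eq_mul, Polynomial.eval_mul,
      Polynomial.eval_natCast, Polynomial.eval_X] at this
    rw [Finset.sum_range] at this
    calc _ = M / n * ∑ k : Fin (n + 1), (k : ℝ) * (bernsteinPolynomial ℝ n k).eval (x / M) := by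
          rw [Finset.mul_sum]
          refine Finset.sum_congr rfl fun k _ => by ring
      _ = x := by rw [this]; field_simp
  · have h1 := (ContinuousMap.dist_apply_le_dist (f := bernsteinApproximation n g) (g := g)
      y).trans_lt hn
    rw [Real.dist_eq, bernsteinApproximation.apply] at h1
    have h2 : g y = f x := by simp only [g, ContinuousMap.coe_mk, hMy]
    rw [h2] at h1
    have h3 := (abs_lt.1 h1).2
    simp only [hb]
    have h4 : ∑ k : Fin (n + 1), f (M * (k / n)) * bernstein n k y
        = ∑ k : Fin (n + 1), bernstein n k y • g (bernstein.z k) :=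
      Finset.sum_congr rfl fun k _ => by rw [smul_eq_mul, mul_comm]; rfl
    rw [h4]
    linarith

/-- The Davis–Choi–Jensen inequality for subunital positive linear maps. -/
theorem OperatorConvexOn.cfc_map_le_map_cfc {f : ℝ → ℝ} (hf : OperatorConvexOn f)
    (hfc : ContinuousOn f (Set.Ici 0)) (hf0 : f 0 ≤ 0) (Ψ : (E →L[ℂ] E) →ₗ[ℂ] (F →L[ℂ] F))
    (hΨ : ∀ A : E →L[ℂ] E, 0 ≤ A → 0 ≤ Ψ A) (hΨ1 : Ψ 1 ≤ 1) {A : E →L[ℂ] E} (hA : 0 ≤ A) :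
    cfc f (Ψ A) ≤ Ψ (cfc f A) := by
  have hAsa : IsSelfAdjoint A := .of_nonneg hA
  have hΨmono : ∀ {X Y : E →L[ℂ] E}, X ≤ Y → Ψ X ≤ Ψ Y := fun {X Y} h => by
    have := hΨ _ (sub_nonneg.2 h)
    rwa [map_sub, sub_nonneg] at this
  have hspec : spectrum ℝ A ⊆ Set.Icc 0 (‖A‖ + 1) := by
    intro x hx
    refine ⟨spectrum_nonneg_of_nonneg hA hx, ?_⟩
    rcases subsingleton_or_nontrivial E with hE | hE
    · have : Subsingleton (E →L[ℂ] E) := inferInstance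
      simp [spectrum.of_subsingleton] at hx
    · linarith [(le_abs_self x).trans (spectrum.norm_le_norm_of_mem hx)]
  have hfA : ContinuousOn f (spectrum ℝ A) := hfc.mono fun x hx => (hspec hx).1
  have key : ∀ ε : ℝ, 0 < ε → cfc f (Ψ A) ≤ Ψ (cfc f A) + ε • (1 : F →L[ℂ] F) := by
    intro ε hε
    obtain ⟨n, t, b, ht, hb, hx⟩ :=
      exists_weights_approximating hfc (M := ‖A‖ + 1) (by positivity) hε
    have hsum : ∀ c : Fin n → ℝ,
        ∑ k, c k • cfc (b k) A = cfc (fun x => ∑ k, c k * b k x) A := by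
      intro c
      rw [show (fun x => ∑ k, c k * b k x) = ∑ k, fun x => c k * b k x by ext; simp,
        cfc_sum_univ _ _ fun k => by fun_prop]
      exact Finset.sum_congr rfl fun k _ => (cfc_const_mul _ _ _ (hb k).continuousOn).symm
    have hΨsum : ∀ c : Fin n → ℝ,
        ∑ k, c k • Ψ (cfc (b k) A) = Ψ (cfc (fun x => ∑ k, c k * b k x) A) := by
      intro c
      rw [← hsum, map_sum]
      exact Finset.sum_congr rfl fun k _ => (LinearMap.map_smul_of_tower Ψ _ _).symm
    have h1 := hf.cfc_sum_smul_le hfc hf0 (C := fun k => Ψ (cfc (b k) A))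
      (fun k => hΨ _ (cfc_nonneg fun x h => (hx x (hspec h)).1 k)) (by
        have := hΨsum fun _ => 1
        simp only [one_smul, one_mul] at this
        rw [this, cfc_congr (g := fun _ => 1) fun x h => (hx x (hspec h)).2.1, cfc_const_one ℝ A]
        exact hΨ1) ht
    rw [hΨsum t, hΨsum fun k => f (t k),
      cfc_congr (g := id) (f := fun x => ∑ k, t k * b k x) fun x h => (hx x (hspec h)).2.2.1,
      cfc_id ℝ A] at h1
    have h2 : cfc (fun x => ∑ k, f (t k) * b k x) A ≤ cfc f A + ε • (1 : E →L[ℂ] E) := by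
      rw [← Algebra.algebraMap_eq_smul_one, ← cfc_add_const ε f A hfA]
      exact cfc_mono (fun x h => (hx x (hspec h)).2.2.2) (by fun_prop) (by fun_prop)
    refine (h1.trans (hΨmono h2)).trans ?_
    rw [map_add, LinearMap.map_smul_of_tower]
    exact add_le_add_right (smul_le_smul_of_nonneg_left hΨ1 hε.le) _
  have hlim : Filter.Tendsto (fun ε : ℝ => Ψ (cfc f A) + ε • (1 : F →L[ℂ] F))
      (nhdsWithin 0 (Set.Ioi 0)) (nhds (Ψ (cfc f A))) := by
    have : Continuous fun ε : ℝ => Ψ (cfc f A) + ε • (1 : F →L[ℂ] F) := by fun_prop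
    simpa using (this.tendsto 0).mono_left nhdsWithin_le_nhds
  exact ge_of_tendsto hlim (Filter.eventually_of_mem self_mem_nhdsWithin key)

theorem OperatorConcaveOn.neg {h : ℝ → ℝ} (hh : OperatorConcaveOn h) :
    OperatorConvexOn fun t => -h t := by
  intro K _ _ _ A B hA hB hAs hBs lam hlam
  simp only [cfc_neg, smul_neg, ← neg_add]
  exact neg_le_neg (hh K A B hA hB hAs hBs lam hlam)

theorem opSqrt_mul_opInvSqrt_s5 {R : E →L[ℂ] E} (hR : IsSelfAdjoint R)
    (hpos : ∀ x ∈ spectrum ℝ R, 0 < x) : opSqrt R * opInvSqrt R = 1 := by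
  have hc : ContinuousOn (fun t : ℝ => (Real.sqrt t)⁻¹) (spectrum ℝ R) :=
    Real.continuous_sqrt.continuousOn.inv₀ fun x hx => (Real.sqrt_pos.2 (hpos x hx)).ne'
  rw [opSqrt, opInvSqrt, ← cfc_mul _ _ R Real.continuous_sqrt.continuousOn hc,
    cfc_congr (g := fun _ => 1) fun x hx => mul_inv_cancel₀ (Real.sqrt_pos.2 (hpos x hx)).ne',
    cfc_const_one ℝ R]

theorem opInvSqrt_mul_opSqrt_s5 {R : E →L[ℂ] E} (hR : IsSelfAdjoint R)
    (hpos : ∀ x ∈ spectrum ℝ R, 0 < x) : opInvSqrt R * opSqrt R = 1 := by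
  rw [← opSqrt_mul_opInvSqrt_s5 hR hpos]
  exact cfc_commute_cfc _ _ R

theorem opSqrt_mul_opSqrt {R : E →L[ℂ] E} (hR : IsSelfAdjoint R)
    (hpos : ∀ x ∈ spectrum ℝ R, 0 < x) : opSqrt R * opSqrt R = R := by
  rw [opSqrt, ← cfc_mul _ _ R Real.continuous_sqrt.continuousOn Real.continuous_sqrt.continuousOn,
    cfc_congr (f := fun x => √x * √x) (g := id) fun x hx => Real.mul_self_sqrt (hpos x hx).le, cfc_id ℝ R]

theorem opSqrt_nonneg (R : E →L[ℂ] E) : 0 ≤ opSqrt R := cfc_nonneg fun _ _ => Real.sqrt_nonneg _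

theorem opInvSqrt_nonneg (R : E →L[ℂ] E) : 0 ≤ opInvSqrt R :=
  cfc_nonneg fun _ _ => inv_nonneg.2 (Real.sqrt_nonneg _)

theorem spectrum_cfc_pos {h : ℝ → ℝ} (hc : ContinuousOn h (Set.Ici 0))
    (hpos : ∀ t : ℝ, 0 ≤ t → 0 < h t) {B : E →L[ℂ] E} (hB : 0 ≤ B) :
    ∀ x ∈ spectrum ℝ (cfc h B), 0 < x := by
  intro x hx
  have hBsa : IsSelfAdjoint B := .of_nonneg hB
  rw [cfc_map_spectrum h B hBsa (hc.mono fun x hx => spectrum_nonneg_of_nonneg hB hx)] at hx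
  obtain ⟨y, hy, rfl⟩ := hx
  exact hpos y (spectrum_nonneg_of_nonneg hB hy)

end OperatorJensen

/-- Choi–Davis–Jensen type inequality for `fΔh`: if `f` is operator convex with
`f(0) ≤ 0`, `h` is operator concave with `h > 0` on `[0, ∞)`, and `Φ` is a positive
linear map with `Φ(I) ≤ I`, then `(fΔh)(Φ(A), Φ(B)) ≤ Φ((fΔh)(A, B))`. -/
theorem stmt_5 {K : Type} [NormedAddCommGroup K] [InnerProductSpace ℂ K] [CompleteSpace K]
    (f h : ℝ → ℝ)
    (hf_cont : ContinuousOn f (Set.Ici (0 : ℝ))) (hh_cont : ContinuousOn h (Set.Ici (0 : ℝ)))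
    (hf : OperatorConvexOn f) (hf0 : f 0 ≤ 0)
    (hh : OperatorConcaveOn h) (hhpos : ∀ t : ℝ, 0 ≤ t → 0 < h t)
    (Φ : (H →L[ℂ] H) →ₗ[ℂ] (K →L[ℂ] K))
    (hΦpos : ∀ A : H →L[ℂ] H, 0 ≤ A → 0 ≤ Φ A) (hΦ1 : Φ 1 ≤ 1)
    (A B : H →L[ℂ] H) (hA : 0 ≤ A) (hB : 0 ≤ B) :
    fDelta f h (Φ A) (Φ B) ≤ Φ (fDelta f h A B) := by
  have hΦmono : ∀ {X Y : H →L[ℂ] H}, X ≤ Y → Φ X ≤ Φ Y := fun {X Y} h => by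
    have := hΦpos _ (sub_nonneg.2 h)
    rwa [map_sub, sub_nonneg] at this
  have hΦB := hΦpos B hB
  have hRpos := spectrum_cfc_pos hh_cont hhpos hB
  have hQpos := spectrum_cfc_pos hh_cont hhpos hΦB
  have hΦh : Φ (cfc h B) ≤ cfc h (Φ B) := by
    have := hh.neg.cfc_map_le_map_cfc hh_cont.neg (neg_nonpos.2 (hhpos 0 le_rfl).le) Φ hΦpos hΦ1 hB
    rwa [cfc_neg, cfc_neg, map_neg, neg_le_neg_iff] at this
  unfold fDelta
  have hRsa : IsSelfAdjoint (cfc h B) := cfc_predicate h B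
  have hQsa : IsSelfAdjoint (cfc h (Φ B)) := cfc_predicate h (Φ B)
  generalize cfc h B = R at *
  generalize cfc h (Φ B) = Q at *
  let Ψ : (H →L[ℂ] H) →ₗ[ℂ] (K →L[ℂ] K) :=
    LinearMap.mulLeft ℂ (opInvSqrt Q) ∘ₗ LinearMap.mulRight ℂ (opInvSqrt Q) ∘ₗ Φ ∘ₗ
      LinearMap.mulLeft ℂ (opSqrt R) ∘ₗ LinearMap.mulRight ℂ (opSqrt R)
  have hΨ : ∀ X, Ψ X = opInvSqrt Q * Φ (opSqrt R * X * opSqrt R) * opInvSqrt Q := fun X => by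
    simp [Ψ, mul_assoc]
  have hΨpos : ∀ X, 0 ≤ X → 0 ≤ Ψ X := fun X hX => by
    rw [hΨ]
    exact conjugate_nonneg_of_nonneg (hΦpos _ (conjugate_nonneg_of_nonneg hX (opSqrt_nonneg R)))
      (opInvSqrt_nonneg Q)
  have hΨ1 : Ψ 1 ≤ 1 := by
    rw [hΨ, mul_one, opSqrt_mul_opSqrt hRsa hRpos]
    refine (conjugate_le_conjugate_of_nonneg hΦh (opInvSqrt_nonneg Q)).trans_eq ?_
    nth_rw 2 [← opSqrt_mul_opSqrt hQsa hQpos]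
    rw [← mul_assoc, opInvSqrt_mul_opSqrt_s5 hQsa hQpos, one_mul, opSqrt_mul_opInvSqrt_s5 hQsa hQpos]
  have hΨA : Ψ (opInvSqrt R * A * opInvSqrt R) = opInvSqrt Q * Φ A * opInvSqrt Q := by
    rw [hΨ, mul_assoc (opSqrt R), mul_assoc _ _ (opSqrt R), opInvSqrt_mul_opSqrt_s5 hRsa hRpos,
      mul_one, ← mul_assoc, opSqrt_mul_opInvSqrt_s5 hRsa hRpos, one_mul]
  have hJ := hf.cfc_map_le_map_cfc hf_cont hf0 Ψ hΨpos hΨ1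
    (conjugate_nonneg_of_nonneg hA (opInvSqrt_nonneg R))
  rw [hΨA, hΨ] at hJ
  refine (conjugate_le_conjugate_of_nonneg hJ (opSqrt_nonneg Q)).trans_eq ?_
  rw [mul_assoc (opSqrt Q), mul_assoc _ _ (opSqrt Q), opInvSqrt_mul_opSqrt_s5 hQsa hQpos, mul_one,
    ← mul_assoc, opSqrt_mul_opInvSqrt_s5 hQsa hQpos, one_mul]
end
end
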